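/- Let Γ be a polycyclic group. Assume that every finite-index subgroup Λ of Γ satisfies the ℝ*-symmetry of first cohomology: for all real additive characters f₁, f₂ of Λ and every nonzero real t, dim_ℂ H¹(Λ, ℂ_{E(t f₁ + i f₂)}) = dim_ℂ H¹(Λ, ℂ_{E(f₁ + i f₂)}). Then Γ is virtually nilpotent, i.e. Γ admits a nilpotent subgroup of finite index. -/

import Mathlib

/-- The character `γ ↦ exp(f₁(γ) + i·f₂(γ))` associated to two real additive
characters `f₁ f₂ : Γ → (ℝ, +)`. -/
noncomputable def expChar {Γ : Type*} [Group Γ] (f₁ f₂ : Γ →* Multiplicative ℝ) : Γ →* ℂˣ where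
  toFun γ := Units.mk0
    (Complex.exp (Complex.ofReal (Multiplicative.toAdd (f₁ γ)) +
      Complex.I * Complex.ofReal (Multiplicative.toAdd (f₂ γ))))
    (Complex.exp_ne_zero _)
  map_one' := by
    ext
    simp
  map_mul' x y := by
    ext
    simp only [map_mul, toAdd_mul, Units.val_mk0, Units.val_mul]
    push_cast
    rw [← Complex.exp_add]
    congr 1
    ring

/-- Scaling of a real additive character by a real number `t`. -/
def smulAddChar {Γ : Type*} [Group Γ] (t : ℝ) (f : Γ →* Multiplicative ℝ) :
    Γ →* Multiplicative ℝ where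
  toFun γ := Multiplicative.ofAdd (t * Multiplicative.toAdd (f γ))
  map_one' := by simp
  map_mul' x y := by
    simp [mul_add, ← ofAdd_add]

/-- The 1-dimensional representation `ℂ_ρ` of `Γ` associated to a character `ρ : Γ → ℂˣ`. -/
noncomputable def charRep {Γ : Type} [Group Γ] (ρ : Γ →* ℂˣ) : Representation ℂ Γ ℂ where
  toFun γ := (ρ γ : ℂ) • LinearMap.id
  map_one' := by
    simp only [map_one, Units.val_one, one_smul]
    rfl
  map_mul' x y := LinearMap.ext fun v => by
    simp only [LinearMap.smul_apply, LinearMap.id_apply, Module.End.mul_apply, smul_eq_mul,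
      Units.val_mul, map_mul]
    ring

noncomputable def dimH1 {Γ : Type} [Group Γ] (ρ : Γ →* ℂˣ) : Cardinal :=
  Module.rank ℂ (groupCohomology (Rep.of (charRep ρ)) 1)

/-- A group is polycyclic if it admits a finite subnormal chain with cyclic quotients. -/
def IsPolycyclic (Γ : Type*) [Group Γ] : Prop :=
  ∃ (n : ℕ) (s : Fin (n + 1) → Subgroup Γ),
    s 0 = ⊤ ∧ s (Fin.last n) = ⊥ ∧
    ∀ i : Fin n,
      s i.succ ≤ s i.castSucc ∧
      ∃ _ : ((s i.succ).subgroupOf (s i.castSucc)).Normal,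
        IsCyclic (↥(s i.castSucc) ⧸ (s i.succ).subgroupOf (s i.castSucc))


namespace PVN

open groupCohomology commutatorElement

/-- crossed homomorphism for `ρ` -/
def IsCoc {G : Type*} [Group G] (ρ : G →* ℂˣ) (c : G → ℂ) : Prop :=
  ∀ x y, c (x * y) = c x + ρ x * c y

def IsCob {G : Type*} [Group G] (ρ : G →* ℂˣ) (c : G → ℂ) : Prop :=
  ∃ v : ℂ, ∀ x, c x = ρ x * v - v

lemma dimH1_ne_zero_iff {G : Type} [Group G] (ρ : G →* ℂˣ) :
    dimH1 ρ ≠ 0 ↔ ∃ c : G → ℂ, IsCoc ρ c ∧ ¬ IsCob ρ c := by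
  have hcob : ∀ c : G → ℂ, c ∈ coboundaries₁ (Rep.of (charRep ρ)) ↔ IsCob ρ c := by
    intro c
    constructor
    · rintro ⟨v, hv⟩
      exact ⟨v, fun x => (congrFun hv x).symm⟩
    · rintro ⟨v, hv⟩
      exact ⟨v, funext fun x => (hv x).symm⟩
  have hcoc : ∀ c : G → ℂ, c ∈ cocycles₁ (Rep.of (charRep ρ)) ↔ IsCoc ρ c := by
    intro c
    rw [mem_cocycles₁_iff]
    refine forall_congr' fun x => forall_congr' fun y => ?_
    constructor
    · intro h
      rw [h, add_comm]
      rfl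
    · intro h
      rw [h, add_comm]
      rfl
  rw [dimH1, Ne, rank_zero_iff_forall_zero]
  constructor
  · intro h
    push Not at h
    obtain ⟨x, hx⟩ := h
    revert hx
    refine H1_induction_on x ?_
    intro c hc
    refine ⟨c, (hcoc _).1 c.2, fun hb => hc ?_⟩
    rw [H1π_eq_zero_iff]
    exact (hcob _).2 hb
  · rintro ⟨c, h1, h2⟩ h
    apply h2
    rw [← hcob]
    exact (H1π_eq_zero_iff (⟨c, (hcoc c).2 h1⟩ : cocycles₁ (Rep.of (charRep ρ)))).1 (h _)

/-- homs `B → ℂ` killing `M`, extended by zero -/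
def W {G : Type*} [Group G] (M B : Subgroup G) : Submodule ℂ (G → ℂ) where
  carrier := {φ | (∀ x, x ∉ B → φ x = 0) ∧ (∀ x ∈ B, ∀ y ∈ B, φ (x * y) = φ x + φ y) ∧
    ∀ x ∈ M, φ x = 0}
  zero_mem' := by simp
  add_mem' := by
    rintro φ ψ ⟨h1, h2, h3⟩ ⟨k1, k2, k3⟩
    refine ⟨fun x hx => by simp [h1 x hx, k1 x hx], fun x hx y hy => ?_,
      fun x hx => by simp [h3 x hx, k3 x hx]⟩
    simp only [Pi.add_apply, h2 x hx y hy, k2 x hx y hy]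
    ring
  smul_mem' := by
    rintro r φ ⟨h1, h2, h3⟩
    refine ⟨fun x hx => by simp [h1 x hx], fun x hx y hy => ?_, fun x hx => by simp [h3 x hx]⟩
    simp only [Pi.smul_apply, h2 x hx y hy, smul_add]

lemma W_finite {G : Type*} [Group G] (M B : Subgroup G) (hB : B.FG) :
    FiniteDimensional ℂ (W M B) := by
  obtain ⟨S, hS⟩ := hB
  let ev : W M B →ₗ[ℂ] (S → ℂ) :=
    { toFun := fun φ s => φ.1 s
      map_add' := fun _ _ => rfl
      map_smul' := fun _ _ => rfl }
  refine FiniteDimensional.of_injective ev ?_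
  rw [← LinearMap.ker_eq_bot, LinearMap.ker_eq_bot']
  rintro ⟨φ, h1, h2, h3⟩ h
  have hone : φ 1 = 0 := by
    have := h2 1 B.one_mem 1 B.one_mem
    rw [mul_one] at this
    linear_combination -this
  have key : ∀ x ∈ B, φ x = 0 := by
    intro x hx
    rw [← hS] at hx
    induction hx using Subgroup.closure_induction with
    | mem x hx => exact congrFun h ⟨x, hx⟩
    | one => exact hone
    | mul x y hx hy ihx ihy =>
      rw [hS] at hx hy
      rw [h2 x hx y hy, ihx, ihy, add_zero]
    | inv x hx ih =>
      rw [hS] at hx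
      have := h2 x hx x⁻¹ (B.inv_mem hx)
      rw [mul_inv_cancel, hone, ih] at this
      linear_combination -this
  ext x
  by_cases hx : x ∈ B
  · exact key x hx
  · exact h1 x hx

/-- conjugation representation on functions -/
def L (G : Type*) [Group G] : Representation ℂ G (G → ℂ) where
  toFun g := LinearMap.funLeft ℂ ℂ (fun a => g⁻¹ * a * g)
  map_one' := by
    ext φ a
    simp [LinearMap.funLeft]
  map_mul' g h := by
    refine LinearMap.ext fun φ => funext fun a => ?_
    simp [LinearMap.funLeft, mul_assoc]

@[simp] lemma L_apply {G : Type*} [Group G] (g : G) (φ : G → ℂ) (a : G) :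
    L G g φ a = φ (g⁻¹ * a * g) := rfl

lemma L_mem_W {G : Type*} [Group G] {M B : Subgroup G} {g : G}
    (hM : g ∈ Subgroup.normalizer (M : Set G)) (hB : g ∈ Subgroup.normalizer (B : Set G))
    {φ : G → ℂ} (hφ : φ ∈ W M B) : L G g φ ∈ W M B := by
  obtain ⟨h1, h2, h3⟩ := hφ
  have eB : ∀ x, x ∈ B ↔ g⁻¹ * x * g ∈ B := by
    intro x
    have := (Subgroup.mem_normalizer_iff.1 hB) (g⁻¹ * x * g)
    rw [this]
    simp [mul_assoc]
  have eM : ∀ x, x ∈ M ↔ g⁻¹ * x * g ∈ M := by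
    intro x
    have := (Subgroup.mem_normalizer_iff.1 hM) (g⁻¹ * x * g)
    rw [this]
    simp [mul_assoc]
  refine ⟨fun x hx => ?_, fun x hx y hy => ?_, fun x hx => ?_⟩
  · rw [L_apply]
    exact h1 _ (fun h => hx ((eB x).2 h))
  · simp only [L_apply]
    rw [← h2 _ ((eB x).1 hx) _ ((eB y).1 hy)]
    congr 1
    group
  · rw [L_apply]
    exact h3 _ ((eM x).1 hx)

/-- The one-parameter family cannot all have cohomology. -/
lemma family_contra {G : Type*} [Group G] (hfg : (commutator G).FG)
    (f₁ f₂ : G →* Multiplicative ℝ) (g : G) (hg : Multiplicative.toAdd (f₁ g) ≠ 0)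
    (h : ∀ t : ℝ, t ≠ 0 → ∃ c : G → ℂ, IsCoc (expChar (smulAddChar t f₁) f₂) c ∧
      ¬ IsCob (expChar (smulAddChar t f₁) f₂) c) : False := by
  have := W_finite ⊥ (commutator G) hfg
  have nG : ∀ N : Subgroup G, N.Normal → ∀ x, x ∈ Subgroup.normalizer (N : Set G) := by
    intro N hN x
    rw [Subgroup.normalizer_eq_top]
    trivial
  let T : Module.End ℂ (W ⊥ (commutator G)) :=
    (L G g⁻¹).restrict (fun φ hφ => L_mem_W (nG _ inferInstance _) (nG _ inferInstance _) hφ)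
  let ev : ℝ → ℂ := fun t => (expChar (smulAddChar t f₁) f₂ g : ℂ)
  have hnorm : ∀ t, ‖ev t‖ = Real.exp (t * Multiplicative.toAdd (f₁ g)) := by
    intro t
    simp [ev, expChar, smulAddChar, Complex.norm_exp]
  have hinj : Function.Injective ev := by
    intro s t hst
    have := congrArg norm hst
    rw [hnorm, hnorm, Real.exp_eq_exp] at this
    exact mul_right_cancel₀ hg this
  have hev : ∀ t : ℝ, t ≠ 0 → T.HasEigenvalue (ev t) := by
    intro t ht
    obtain ⟨c, hc, hnc⟩ := h t ht
    set ρ := expChar (smulAddChar t f₁) f₂ with hρ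
    have hρ1 : ∀ x ∈ commutator G, ρ x = 1 := fun x hx =>
      Abelianization.commutator_subset_ker ρ hx
    have hρg : (ρ g : ℂ) ≠ 1 := by
      intro h1
      have h2 := hnorm t
      have h3 : ev t = 1 := h1
      rw [h3, norm_one] at h2
      have := (Real.exp_eq_one_iff _).1 h2.symm
      exact (mul_ne_zero ht hg) this
    have hc1 : c 1 = 0 := by
      have := hc 1 1
      simp at this
      exact this
    have hcomm : ∃ a ∈ commutator G, c a ≠ 0 := by
      by_contra! hz
      apply hnc
      refine ⟨c g / (ρ g - 1), fun x => ?_⟩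
      have e1 : c (x * g) = c (g * x) := by
        have : x * g = ⁅x, g⁆ * (g * x) := by simp [commutatorElement_def, mul_assoc]
        have hm : ⁅x, g⁆ ∈ commutator G :=
          Subgroup.commutator_mem_commutator (Subgroup.mem_top _) (Subgroup.mem_top _)
        rw [this, hc, hz _ hm, hρ1 _ hm]
        simp
      rw [hc, hc] at e1
      have : (ρ g : ℂ) - 1 ≠ 0 := sub_ne_zero.2 hρg
      field_simp
      linear_combination -e1
    obtain ⟨a, ha, hca⟩ := hcomm
    classical
    let φ : G → ℂ := fun x => if x ∈ commutator G then c x else 0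
    have hφ : φ ∈ W ⊥ (commutator G) := by
      refine ⟨fun x hx => if_neg hx, fun x hx y hy => ?_, fun x hx => ?_⟩
      · simp only [φ, if_pos hx, if_pos hy, if_pos (Subgroup.mul_mem _ hx hy)]
        rw [hc, hρ1 x hx]
        simp
      · rw [Subgroup.mem_bot] at hx
        subst hx
        simp [φ, hc1]
    refine Module.End.hasEigenvalue_of_hasEigenvector (x := ⟨φ, hφ⟩) ⟨?_, ?_⟩
    · rw [Module.End.mem_eigenspace_iff]
      apply Subtype.ext
      funext x
      change φ (g⁻¹⁻¹ * x * g⁻¹) = ρ g * φ x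
      rw [inv_inv]
      by_cases hx : x ∈ commutator G
      · have hx' : g * x * g⁻¹ ∈ commutator G := (inferInstance : (commutator G).Normal).conj_mem x hx g
        simp only [φ, if_pos hx, if_pos hx']
        have e1 : c (g * g⁻¹) = 0 := by rw [mul_inv_cancel, hc1]
        rw [hc] at e1
        rw [hc, hc, map_mul, hρ1 x hx, mul_one]
        linear_combination e1
      · have hx' : g * x * g⁻¹ ∉ commutator G := by
          intro h'
          apply hx
          have := (inferInstance : (commutator G).Normal).conj_mem _ h' g⁻¹
          simpa [mul_assoc] using this
        simp only [φ, if_neg hx, if_neg hx', mul_zero]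
    · intro h0
      have := congrFun (congrArg Subtype.val h0) a
      simp only [φ, if_pos ha] at this
      exact hca this
  have hfin : (Set.range (fun n : ℕ => ev (n + 1))).Finite := by
    refine (Module.End.finite_hasEigenvalue T).subset ?_
    rintro _ ⟨n, rfl⟩
    exact hev _ (by positivity)
  exact Set.infinite_range_of_injective (fun a b hab => by
    have := hinj hab
    exact_mod_cast (add_right_cancel this)) hfin

end PVN

namespace PVN

open groupCohomology commutatorElement

lemma lift_free (n : ℕ) (r : Multiplicative (Fin n →₀ ℤ) →* ℂˣ) :
    ∃ l₁ l₂ : Multiplicative (Fin n →₀ ℤ) →* Multiplicative ℝ, expChar l₁ l₂ = r := by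
  let l₁ : Multiplicative (Fin n →₀ ℤ) →* Multiplicative ℝ :=
    { toFun := fun v => Multiplicative.ofAdd (Real.log ‖(r v : ℂ)‖)
      map_one' := by simp
      map_mul' := fun x y => by
        simp only [map_mul, Units.val_mul, norm_mul]
        rw [Real.log_mul (by simp) (by simp), ofAdd_add] }
  let l₂ : Multiplicative (Fin n →₀ ℤ) →* Multiplicative ℝ :=
    AddMonoidHom.toMultiplicative (Finsupp.liftAddHom (fun i : Fin n =>
      zmultiplesHom ℝ (Complex.arg (r (Multiplicative.ofAdd (Finsupp.single i 1))))))
  refine ⟨l₁, l₂, ?_⟩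
  apply MonoidHom.toAdditiveRight.injective
  apply Finsupp.addHom_ext'
  intro i
  apply AddMonoidHom.ext_int
  apply Additive.toMul.injective
  ext
  change Complex.exp (((Real.log ‖(r (Multiplicative.ofAdd (Finsupp.single i 1)) : ℂ)‖ : ℝ) : ℂ) +
    Complex.I * ((l₂ (Multiplicative.ofAdd (Finsupp.single i 1))).toAdd : ℂ)) =
    (r (Multiplicative.ofAdd (Finsupp.single i 1)) : ℂ)
  have h2 : (l₂ (Multiplicative.ofAdd (Finsupp.single i 1))).toAdd =
    Complex.arg (r (Multiplicative.ofAdd (Finsupp.single i 1))) := by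
    change Finsupp.liftAddHom _ (Finsupp.single i 1) = _
    simp
  rw [h2, Complex.exp_add, mul_comm Complex.I, ← Complex.ofReal_exp, Real.exp_log (by simp)]
  exact Complex.norm_mul_exp_arg_mul_I _

lemma lift_angle {G : Type} [Group G] (hG : Group.FG G) (ρ : G →* ℂˣ) :
    ∃ K : Subgroup G, K.FiniteIndex ∧ ∃ f₁ f₂ : K →* Multiplicative ℝ,
      ∀ x : K, ρ x = expChar f₁ f₂ x := by
  have : Group.FG (Abelianization G) :=
    Group.fg_of_surjective (f := Abelianization.of) (QuotientGroup.mk_surjective)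
  obtain ⟨n, ι, _, p, hp, e, ⟨E⟩⟩ :=
    AddCommGroup.equiv_free_prod_directSum_zmod (Additive (Abelianization G))
  have : ∀ i, NeZero (p i ^ e i) := fun i => ⟨pow_ne_zero _ (hp i).ne_zero⟩
  let D := DirectSum ι fun i => ZMod (p i ^ e i)
  have : Finite D := Finite.of_equiv _ (DirectSum.addEquivProd (fun i => ZMod (p i ^ e i))).symm.toEquiv
  let q : G →* Multiplicative D :=
    (AddMonoidHom.toMultiplicativeRight ((AddMonoidHom.snd _ _).comp E.toAddMonoidHom)).comp
      Abelianization.of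
  let v : G →* Multiplicative (Fin n →₀ ℤ) :=
    (AddMonoidHom.toMultiplicativeRight ((AddMonoidHom.fst _ _).comp E.toAddMonoidHom)).comp
      Abelianization.of
  let r : Multiplicative (Fin n →₀ ℤ) →* ℂˣ :=
    (Abelianization.lift ρ).comp (AddMonoidHom.toMultiplicativeLeft (E.symm.toAddMonoidHom.comp
      (AddMonoidHom.inl _ _)))
  obtain ⟨l₁, l₂, hl⟩ := lift_free n r
  have hK : q.ker.FiniteIndex := by
    infer_instance
  refine ⟨q.ker, hK, (l₁.comp v).comp q.ker.subtype, (l₂.comp v).comp q.ker.subtype, ?_⟩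
  rintro ⟨x, hx⟩
  have h1 : ρ x = r (v x) := by
    have : E.symm ((v x).toAdd, 0) = Additive.ofMul (Abelianization.of x) := by
      rw [AddEquiv.symm_apply_eq]
      refine Prod.ext rfl ?_
      exact hx.symm
    change ρ x = Abelianization.lift ρ (E.symm ((v x).toAdd, 0)).toMul
    rw [this]
    simp
  change ρ x = _
  rw [h1, ← hl]
  rfl

lemma coc_one {G : Type*} [Group G] {ρ : G →* ℂˣ} {c : G → ℂ} (hc : IsCoc ρ c) : c 1 = 0 := by
  have := hc 1 1
  simpa using this

lemma coc_pow {G : Type*} [Group G] {ρ : G →* ℂˣ} {c : G → ℂ} (hc : IsCoc ρ c) {b : G}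
    (hb : ρ b = 1) (k : ℕ) : c (b ^ k) = k * c b := by
  induction k with
  | zero => simp [coc_one hc]
  | succ k ih =>
    rw [pow_succ, hc, ih, map_pow, hb]
    push_cast
    simp
    ring

lemma noBad {Γ : Type} [Group Γ] (hfg : ∀ K : Subgroup Γ, K.FG)
    (hsym : ∀ Λ : Subgroup Γ, Λ.FiniteIndex →
      ∀ (f₁ f₂ : Λ →* Multiplicative ℝ) (t : ℝ), t ≠ 0 →
        dimH1 (expChar (smulAddChar t f₁) f₂) = dimH1 (expChar f₁ f₂))
    (Λ : Subgroup Γ) (hΛ : Λ.FiniteIndex) (ρ : Λ →* ℂˣ) (c : Λ → ℂ) (hc : IsCoc ρ c)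
    (b : Λ) (hb : ρ b = 1) (hcb : c b ≠ 0) (g : Λ) : ‖(ρ g : ℂ)‖ = 1 := by
  by_contra hg
  obtain ⟨K, hK, f₁, f₂, hf⟩ := lift_angle ((Group.fg_iff_subgroup_fg _).2 (hfg Λ)) ρ
  let K' : Subgroup Γ := K.map Λ.subtype
  have hK' : K'.FiniteIndex := by
    constructor
    rw [Subgroup.index_map_subtype]
    exact mul_ne_zero hK.index_ne_zero hΛ.index_ne_zero
  let e : K ≃* K' := K.equivMapOfInjective Λ.subtype Λ.subtype_injective
  have key : ∀ x : K, (expChar (f₁.comp e.symm.toMonoidHom) (f₂.comp e.symm.toMonoidHom) (e x)) =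
      ρ x := by
    intro x
    rw [hf]
    ext
    simp [expChar]
  set F₁ := f₁.comp e.symm.toMonoidHom
  set F₂ := f₂.comp e.symm.toMonoidHom
  have hpow : ∀ x : Λ, ∃ k : ℕ, 0 < k ∧ x ^ k ∈ K := by
    intro x
    obtain ⟨k, hk, -, h⟩ := Subgroup.exists_pow_mem_of_index_ne_zero hK.index_ne_zero x
    exact ⟨k, hk, h⟩
  have hne : dimH1 (expChar F₁ F₂) ≠ 0 := by
    rw [dimH1_ne_zero_iff]
    refine ⟨fun x => c (e.symm x), ?_, ?_⟩
    · intro x y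
      obtain ⟨x, rfl⟩ := e.surjective x
      obtain ⟨y, rfl⟩ := e.surjective y
      rw [key, ← map_mul]
      simp only [MulEquiv.symm_apply_apply, Subgroup.coe_mul]
      exact hc _ _
    · rintro ⟨w, hw⟩
      obtain ⟨k, hk, hbk⟩ := hpow b
      have := hw (e ⟨b ^ k, hbk⟩)
      rw [key] at this
      simp only [MulEquiv.symm_apply_apply, coc_pow hc hb, map_pow, hb] at this
      simp at this
      rcases this with h | h
      · omega
      · exact hcb h
  obtain ⟨k, hk, hgk⟩ := hpow g
  refine family_contra (G := K') ?_ F₁ F₂ (e ⟨g ^ k, hgk⟩) ?_ ?_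
  · have h1 := hfg ((commutator K').map K'.subtype)
    rw [← Group.fg_iff_subgroup_fg] at h1 ⊢
    exact Group.fg_of_surjective (f := ((commutator K').equivMapOfInjective K'.subtype
      K'.subtype_injective).symm.toMonoidHom) (MulEquiv.surjective _)
  · intro h0
    have h1 := congrArg (fun u : ℂˣ => ‖(u : ℂ)‖) (key ⟨g ^ k, hgk⟩)
    simp only [expChar, MonoidHom.coe_mk, OneHom.coe_mk, Units.val_mk0, h0] at h1
    simp [Complex.norm_exp] at h1
    have h2 := (pow_eq_one_iff_of_nonneg (norm_nonneg _) hk.ne').1 h1.symm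
    exact hg h2
  · intro t ht
    rw [← dimH1_ne_zero_iff, hsym K' hK' F₁ F₂ t ht]
    exact hne

end PVN

namespace PVN

open groupCohomology commutatorElement

lemma poly_fg {Γ : Type*} [Group Γ] (h : IsPolycyclic Γ) (K : Subgroup Γ) : K.FG := by
  obtain ⟨n, s, h0, hn, hs⟩ := h
  have key : ∀ i : Fin (n + 1), ∀ K : Subgroup Γ, K ≤ s i → K.FG := by
    intro i
    induction i using Fin.reverseInduction with
    | last =>
      intro K hK
      rw [hn, le_bot_iff] at hK
      rw [hK]
      exact Subgroup.FG.bot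
    | cast i ih =>
      intro K hK
      obtain ⟨hle, hnor, hcyc⟩ := hs i
      let N := (s i.succ).subgroupOf (s i.castSucc)
      let π : K →* (s i.castSucc ⧸ N) := (QuotientGroup.mk' N).comp (Subgroup.inclusion hK)
      obtain ⟨⟨_, ⟨k, rfl⟩⟩, hk⟩ := (inferInstance : IsCyclic π.range).exists_generator
      have hK' : K = (K ⊓ s i.succ) ⊔ Subgroup.zpowers (k : Γ) := by
        apply le_antisymm
        · intro x hx
          obtain ⟨m, hm⟩ := hk ⟨π ⟨x, hx⟩, ⟨x, hx⟩, rfl⟩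
          have hm' : π k ^ m = π ⟨x, hx⟩ := congrArg Subtype.val hm
          rw [← map_zpow] at hm'
          have h1 : π (⟨x, hx⟩ * (k ^ m)⁻¹) = 1 := by
            rw [map_mul, map_inv, hm', mul_inv_cancel]
          have h2 := (QuotientGroup.eq_one_iff _).1 h1
          have h3 : x * ((k : Γ) ^ m)⁻¹ ∈ s i.succ := h2
          have h4 : x * ((k : Γ) ^ m)⁻¹ ∈ K := K.mul_mem hx (K.inv_mem (K.zpow_mem k.2 m))
          have h5 : x = (x * ((k : Γ) ^ m)⁻¹) * (k : Γ) ^ m := by group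
          rw [h5]
          exact Subgroup.mul_mem_sup ⟨h4, h3⟩ ⟨m, rfl⟩
        · refine sup_le inf_le_left ?_
          rw [Subgroup.zpowers_le]
          exact k.2
      rw [hK']
      refine Subgroup.FG.sup (ih _ inf_le_right) ?_
      exact ⟨{(k : Γ)}, by simp [Subgroup.zpowers_eq_closure]⟩
  exact key 0 K (h0 ▸ le_top)

lemma poly_solvable {Γ : Type*} [Group Γ] (h : IsPolycyclic Γ) : Group.IsSolvable Γ := by
  obtain ⟨n, s, h0, hn, hs⟩ := h
  have key : ∀ i : Fin (n + 1), derivedSeries Γ i ≤ s i := by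
    intro i
    induction i using Fin.induction with
    | zero => rw [h0]; exact le_top
    | succ i ih =>
      obtain ⟨hle, hnor, hcyc⟩ := hs i
      change derivedSeries Γ (i + 1) ≤ _
      rw [derivedSeries_succ]
      refine (Subgroup.commutator_mono ih ih).trans ?_
      rw [Subgroup.commutator_le]
      intro x hx y hy
      have := hcyc.isMulCommutative
      let N := (s i.succ).subgroupOf (s i.castSucc)
      let x' : s i.castSucc ⧸ N := QuotientGroup.mk' N ⟨x, hx⟩
      let y' : s i.castSucc ⧸ N := QuotientGroup.mk' N ⟨y, hy⟩
      have h1 : ⁅x', y'⁆ = 1 := commutatorElement_eq_one_iff_mul_comm.2 (this.is_comm.comm _ _)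
      rw [← map_commutatorElement] at h1
      have h2 := (QuotientGroup.eq_one_iff _).1 h1
      exact h2
  refine ⟨n, ?_⟩
  rw [← le_bot_iff, ← hn]
  exact key (Fin.last n)

lemma acc_of_fg {Γ : Type*} [Group Γ] (h : ∀ K : Subgroup Γ, K.FG) :
    WellFoundedGT (Subgroup Γ) := by
  rw [wellFoundedGT_iff_monotone_chain_condition]
  intro a
  obtain ⟨S, hS⟩ := h (⨆ i, a i)
  have hdir : Directed (· ≤ ·) a := a.monotone.directed_le
  have : ∀ x ∈ S, ∃ i, x ∈ a i := by
    intro x hx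
    rw [← Subgroup.mem_iSup_of_directed hdir, ← hS]
    exact Subgroup.subset_closure hx
  choose! f hf using this
  refine ⟨S.sup f, fun m hm => le_antisymm (a.monotone hm) ?_⟩
  refine (le_iSup a m).trans ?_
  rw [← hS, Subgroup.closure_le]
  intro x hx
  exact a.monotone (Finset.le_sup hx) (hf x hx)

/-- virtually nilpotent modulo `M` -/
def VN {Γ : Type*} [Group Γ] (M : Subgroup Γ) : Prop :=
  ∃ H : Subgroup Γ, H.FiniteIndex ∧ ∃ n, H.lowerCentralSeries n ≤ M

lemma finiteIndex_of_map {Γ : Type*} [Group Γ] {H K : Subgroup Γ} (hH : H.FiniteIndex)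
    {X : Type*} (s : Set X) (hs : s.Finite) (F : Γ → X) (hF : ∀ h ∈ H, F h ∈ s)
    (hK : ∀ h ∈ H, ∀ h' ∈ H, F h = F h' → h⁻¹ * h' ∈ K) : K.FiniteIndex := by
  have : Finite s := hs
  have hfin : (K.subgroupOf H).FiniteIndex := by
    have : Finite (H ⧸ K.subgroupOf H) := by
      refine Finite.of_injective
        (β := s) (fun q => ⟨F (q.out : H), hF _ (q.out : H).2⟩) ?_
      intro q q' hq
      have h1 := hK _ (q.out : H).2 _ (q'.out : H).2 (congrArg Subtype.val hq)
      rw [← q.out_eq', ← q'.out_eq']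
      rw [QuotientGroup.eq]
      exact h1
    exact Subgroup.finiteIndex_of_finite_quotient
  constructor
  have h2 : (K ⊓ H).index ≠ 0 := by
    have : K.relIndex H ≠ 0 := hfin.index_ne_zero
    rw [← Subgroup.inf_relIndex_right] at this
    rw [← Subgroup.relIndex_mul_index (inf_le_right : K ⊓ H ≤ H)]
    exact mul_ne_zero this hH.index_ne_zero
  exact ne_zero_of_dvd_ne_zero h2 (Subgroup.index_dvd_of_le inf_le_left)

end PVN

namespace PVN

open groupCohomology commutatorElement

lemma normal_sub {Γ : Type*} [Group Γ] {M B : Subgroup Γ} (_hMB : M ≤ B) (hc : ⁅B, B⁆ ≤ M) :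
    (M.subgroupOf B).Normal := by
  constructor
  intro n hn g
  have h1 : ⁅(g : Γ), (n : Γ)⁆ ∈ M := hc (Subgroup.commutator_mem_commutator g.2 n.2)
  have h2 := M.mul_mem h1 hn
  rw [Subgroup.mem_subgroupOf]
  simpa [commutatorElement_def] using h2

/-- commutative quotient -/
abbrev qComm {Γ : Type*} [Group Γ] {M B : Subgroup Γ} (hc : ⁅B, B⁆ ≤ M)
    [(M.subgroupOf B).Normal] : CommGroup (B ⧸ M.subgroupOf B) :=
  { QuotientGroup.Quotient.group (M.subgroupOf B) with
    mul_comm := by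
      intro a b
      obtain ⟨x, rfl⟩ := QuotientGroup.mk'_surjective _ a
      obtain ⟨y, rfl⟩ := QuotientGroup.mk'_surjective _ b
      rw [← commutatorElement_eq_one_iff_mul_comm, ← map_commutatorElement]
      refine (QuotientGroup.eq_one_iff _).2 ?_
      exact hc (Subgroup.commutator_mem_commutator x.2 y.2) }

lemma mk_mem_W {Γ : Type*} [Group Γ] {M B : Subgroup Γ} (hMB : M ≤ B) [(M.subgroupOf B).Normal]
    (F : B ⧸ M.subgroupOf B →* Multiplicative ℂ) :
    ∃ φ ∈ W M B, ∀ x (hx : x ∈ B), φ x = (F (QuotientGroup.mk' _ ⟨x, hx⟩)).toAdd := by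
  classical
  refine ⟨fun x => if hx : x ∈ B then (F (QuotientGroup.mk' _ ⟨x, hx⟩)).toAdd else 0,
    ⟨fun x hx => dif_neg hx, ?_, ?_⟩, fun x hx => dif_pos hx⟩
  · intro x hx y hy
    simp only [dif_pos hx, dif_pos hy, dif_pos (B.mul_mem hx hy)]
    rw [← toAdd_mul, ← map_mul, ← map_mul]
    rfl
  · intro x hx
    simp only [dif_pos (hMB hx)]
    have : QuotientGroup.mk' (M.subgroupOf B) ⟨x, hMB hx⟩ = 1 := (QuotientGroup.eq_one_iff _).2 hx
    rw [this, map_one]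
    rfl

lemma baerC : Module.Baer ℤ ℂ := by
  have : DivisibleBy ℂ ℤ := by infer_instance
  exact Module.Baer.of_divisible _

lemma finite_quot {Γ : Type*} [Group Γ] {M B : Subgroup Γ} (hB : B.FG) (hMB : M ≤ B)
    (hc : ⁅B, B⁆ ≤ M) (hW : W M B = ⊥) : Finite (B ⧸ M.subgroupOf B) := by
  have hN := normal_sub hMB hc
  let _ := qComm hc
  have hB' : Group.FG B := (Group.fg_iff_subgroup_fg _).2 hB
  have : Group.FG (B ⧸ M.subgroupOf B) :=
    Group.fg_of_surjective (f := QuotientGroup.mk' _) (QuotientGroup.mk'_surjective _)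
  have : AddGroup.FG (Additive (B ⧸ M.subgroupOf B)) := inferInstance
  suffices h : Finite (Additive (B ⧸ M.subgroupOf B)) from h
  apply AddCommGroup.finite_of_fg_isAddTorsion
  intro q
  by_contra hq
  let j : ℤ →+ Additive (B ⧸ M.subgroupOf B) := zmultiplesHom _ q
  have hj : Function.Injective j := by
    have := injective_zsmul_iff_not_isOfFinAddOrder.2 hq
    exact this
  obtain ⟨F, hF⟩ := baerC.extension_property_addMonoidHom j hj (Int.castAddHom ℂ)
  obtain ⟨φ, hφ, hφ'⟩ := mk_mem_W hMB (AddMonoidHom.toMultiplicativeRight F)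
  rw [hW, Submodule.mem_bot] at hφ
  obtain ⟨x, hx⟩ := QuotientGroup.mk'_surjective _ q.toMul
  have h1 := hφ' x x.2
  have h2 : F (j 1) = 1 := by
    have := DFunLike.congr_fun hF 1
    simpa using this
  have h3 : j 1 = q := by simp [j]
  rw [h3] at h2
  change φ x = F (Additive.ofMul (QuotientGroup.mk' _ x)) at h1
  rw [hx, ofMul_toMul, h2, hφ] at h1
  exact zero_ne_one h1

lemma W_ext {Γ : Type*} [Group Γ] {M D B : Subgroup Γ} (hMD : M ≤ D) (hDB : D ≤ B)
    (hc : ⁅B, B⁆ ≤ M) {ψ : Γ → ℂ} (hψ : ψ ∈ W M D) :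
    ∃ φ ∈ W M B, ∀ x ∈ D, φ x = ψ x := by
  have hcD : ⁅D, D⁆ ≤ M := (Subgroup.commutator_mono hDB hDB).trans hc
  have hN := normal_sub (hMD.trans hDB) hc
  have hND := normal_sub hMD hcD
  let _ := qComm hc
  let _ := qComm hcD
  obtain ⟨h1, h2, h3⟩ := hψ
  let ψ₀ : D →* Multiplicative ℂ := MonoidHom.mk' (fun x => Multiplicative.ofAdd (ψ x))
    (fun x y => by simp [h2 x x.2 y y.2])
  let ψ' : D ⧸ M.subgroupOf D →* Multiplicative ℂ := QuotientGroup.lift _ ψ₀ (by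
    intro x hx
    exact h3 x hx)
  let j : D ⧸ M.subgroupOf D →* B ⧸ M.subgroupOf B :=
    QuotientGroup.map _ _ (Subgroup.inclusion hDB) (by
      intro x hx
      exact hx)
  have hj : Function.Injective j := by
    rw [injective_iff_map_eq_one]
    intro a ha
    obtain ⟨x, rfl⟩ := QuotientGroup.mk'_surjective _ a
    have := (QuotientGroup.eq_one_iff (N := M.subgroupOf B) (Subgroup.inclusion hDB x)).1 ha
    exact (QuotientGroup.eq_one_iff _).2 this
  obtain ⟨F, hF⟩ := baerC.extension_property_addMonoidHom (MonoidHom.toAdditive j) hj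
    (MonoidHom.toAdditiveLeft ψ')
  obtain ⟨φ, hφ, hφ'⟩ := mk_mem_W (hMD.trans hDB) (AddMonoidHom.toMultiplicativeRight F)
  refine ⟨φ, hφ, fun x hx => ?_⟩
  rw [hφ' x (hDB hx)]
  exact DFunLike.congr_fun hF (Additive.ofMul (QuotientGroup.mk' _ ⟨x, hx⟩))

lemma W_lt {Γ : Type*} [Group Γ] {M D B : Subgroup Γ} (hB : B.FG) (hMD : M ≤ D) (hDB : D ≤ B)
    (hc : ⁅B, B⁆ ≤ M) {φ : Γ → ℂ} (hφ : φ ∈ W M B) (hφ0 : φ ≠ 0) (hφD : ∀ x ∈ D, φ x = 0) :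
    Module.finrank ℂ (W M D) < Module.finrank ℂ (W M B) := by
  classical
  have := W_finite M B hB
  let r : W M B →ₗ[ℂ] W M D :=
    { toFun := fun φ => ⟨fun x => if x ∈ D then φ.1 x else 0, by
        obtain ⟨φ, h1, h2, h3⟩ := φ
        refine ⟨fun x hx => if_neg hx, fun x hx y hy => ?_, fun x hx => ?_⟩
        · simp only [if_pos hx, if_pos hy, if_pos (D.mul_mem hx hy)]
          exact h2 x (hDB hx) y (hDB hy)
        · simp only [h3 x hx, ite_self]⟩
      map_add' := by
        intro a b
        ext x
        by_cases hx : x ∈ D <;> simp [hx]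
      map_smul' := by
        intro a b
        ext x
        by_cases hx : x ∈ D <;> simp [hx] }
  have hr : Function.Surjective r := by
    intro ψ
    obtain ⟨φ, hφ, h⟩ := W_ext hMD hDB hc ψ.2
    refine ⟨⟨φ, hφ⟩, ?_⟩
    ext x
    by_cases hx : x ∈ D
    · simp [r, hx, h x hx]
    · simp [r, hx, ψ.2.1 x hx]
  have h1 := LinearMap.finrank_range_add_finrank_ker r
  rw [LinearMap.range_eq_top.2 hr, finrank_top] at h1
  have h2 : 0 < Module.finrank ℂ (LinearMap.ker r) := by
    have hex : ∃ x : LinearMap.ker r, x ≠ 0 := by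
      refine ⟨⟨⟨φ, hφ⟩, ?_⟩, ?_⟩
      rotate_left
      · intro h
        exact hφ0 (congrArg (fun u => u.1.1) h)
      rw [LinearMap.mem_ker]
      ext x
      by_cases hx : x ∈ D
      · simp [r, hx, hφD x hx]
      · simp [r, hx]
    have hnt : Nontrivial (LinearMap.ker r) := ⟨_, 0, hex.choose_spec⟩
    exact Module.finrank_pos (R := ℂ) (M := LinearMap.ker r)
  omega

lemma VN_of_finite {Γ : Type*} [Group Γ] {M B : Subgroup Γ}
    (hnM : (Subgroup.normalizer (M : Set Γ)).FiniteIndex)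
    (hnB : (Subgroup.normalizer (B : Set Γ)).FiniteIndex) (hMB : M ≤ B)
    (hc : ⁅B, B⁆ ≤ M) (hfin : Finite (B ⧸ M.subgroupOf B)) (h : VN B) : VN M := by
  obtain ⟨H, hH, n, hn⟩ := h
  have hN := normal_sub hMB hc
  have hind := hnM
  let NM := Subgroup.normalizer (M : Set Γ)
  let NB := Subgroup.normalizer (B : Set Γ)
  let H' := H ⊓ NM ⊓ NB
  have hH' : H'.FiniteIndex := inferInstance
  have BN : B ≤ NM := by
    intro b hb
    rw [Subgroup.mem_normalizer_iff]
    have : ∀ b ∈ B, ∀ m ∈ M, b * m * b⁻¹ ∈ M := by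
      intro b hb m hm
      exact hN.conj_mem ⟨m, hMB hm⟩ hm ⟨b, hb⟩
    intro m
    refine ⟨this b hb m, fun hm => ?_⟩
    have h2 := this b⁻¹ (B.inv_mem hb) _ hm
    simpa [mul_assoc] using h2
  let K : Subgroup Γ :=
    { carrier := {h | h ∈ H' ∧ ∀ b ∈ B, ⁅b, h⁆ ∈ M}
      one_mem' := ⟨H'.one_mem, by simp⟩
      mul_mem' := by
        rintro x y ⟨hx, hx'⟩ ⟨hy, hy'⟩
        refine ⟨H'.mul_mem hx hy, fun b hb => ?_⟩
        have e : ⁅b, x * y⁆ = ⁅b, x⁆ * (x * ⁅b, y⁆ * x⁻¹) := by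
          simp only [commutatorElement_def]; group
        rw [e]
        exact M.mul_mem (hx' b hb) ((Subgroup.mem_normalizer_iff.1 hx.1.2 _).1 (hy' b hb))
      inv_mem' := by
        rintro x ⟨hx, hx'⟩
        refine ⟨H'.inv_mem hx, fun b hb => ?_⟩
        have e : ⁅b, x⁻¹⁆ = x⁻¹ * ⁅b, x⁆⁻¹ * x⁻¹⁻¹ := by
          simp only [commutatorElement_def]; group
        rw [e]
        exact (Subgroup.mem_normalizer_iff.1 (NM.inv_mem hx.1.2) _).1 (M.inv_mem (hx' b hb)) }
  have cB : ∀ h ∈ H', ∀ b : B, h * b * h⁻¹ ∈ B := fun h hh b =>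
    (Subgroup.mem_normalizer_iff.1 hh.2 _).1 b.2
  classical
  have hK : K.FiniteIndex := by
    refine finiteIndex_of_map (X := (B ⧸ M.subgroupOf B) → (B ⧸ M.subgroupOf B)) hH' Set.univ
      Set.finite_univ (fun h q => if hh : h ∈ H' then
        QuotientGroup.mk' _ ⟨h * (q.out : B) * h⁻¹, cB h hh q.out⟩ else 1) (fun _ _ => trivial) ?_
    intro h hh k hk heq
    have hu : h⁻¹ * k ∈ H' := H'.mul_mem (H'.inv_mem hh) hk
    refine ⟨hu, fun b hb => ?_⟩
    set q : B ⧸ M.subgroupOf B := QuotientGroup.mk' _ ⟨b, hb⟩ with hq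
    have h1 := congrFun heq q
    simp only [dif_pos hh, dif_pos hk] at h1
    have h2 := QuotientGroup.eq.1 h1
    have h3 : (h * (q.out : B) * h⁻¹)⁻¹ * (k * (q.out : B) * k⁻¹) ∈ M := h2
    have h4 : (q.out : B)⁻¹ * (⟨b, hb⟩ : B) ∈ M.subgroupOf B := by
      rw [← QuotientGroup.eq, QuotientGroup.out_eq']
      rfl
    have h5 : ((q.out : B) : Γ)⁻¹ * b ∈ M := h4
    set o : Γ := ((q.out : B) : Γ) with ho
    have hoB : o ∈ B := (q.out : B).2
    -- `u = h⁻¹ k`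
    have h6 : o⁻¹ * ((h⁻¹ * k) * o * (h⁻¹ * k)⁻¹) ∈ M := by
      have := (Subgroup.mem_normalizer_iff.1 (NM.inv_mem hh.1.2) _).1 h3
      convert this using 1
      group
    have h7 : (h⁻¹ * k) * (o⁻¹ * b) * (h⁻¹ * k)⁻¹ ∈ M :=
      (Subgroup.mem_normalizer_iff.1 hu.1.2 _).1 h5
    have h8 : b⁻¹ * ((h⁻¹ * k) * b * (h⁻¹ * k)⁻¹) ∈ M := by
      have := M.mul_mem (M.mul_mem (M.inv_mem h5) h6) h7
      convert this using 1
      group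
    have h9 := (Subgroup.mem_normalizer_iff.1 (BN hb) _).1 (M.inv_mem h8)
    convert h9 using 1
    simp only [commutatorElement_def]
    group
  refine ⟨K, hK, n + 1, ?_⟩
  rw [Subgroup.lowerCentralSeries_succ]
  have hKH : K ≤ H := fun x hx => hx.1.1.1
  rw [Subgroup.commutator_le]
  intro x hx y hy
  exact hy.2 x (hn (Subgroup.lowerCentralSeries_mono n hKH hx))

end PVN

namespace PVN

open groupCohomology commutatorElement

lemma eigen {Γ V : Type*} [Group Γ] [AddCommGroup V] [Module ℂ V] (L : Representation ℂ Γ V)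
    (W0 : Submodule ℂ V) [FiniteDimensional ℂ W0] (hW : W0 ≠ ⊥) (H : Subgroup Γ)
    (hH : H.FiniteIndex) (hinv : ∀ h ∈ H, ∀ w ∈ W0, L h w ∈ W0) (n : ℕ)
    (htriv : ∀ h ∈ H.lowerCentralSeries n, ∀ w ∈ W0, L h w = w) :
    ∃ H1 ≤ H, H1.FiniteIndex ∧ ∃ u ∈ W0, u ≠ 0 ∧ ∀ h ∈ H1, ∃ r : ℂ, L h u = r • u := by
  classical
  have hex : ∃ d : ℕ, ∃ H1 ≤ H, H1.FiniteIndex ∧ ∃ U ≤ W0, U ≠ ⊥ ∧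
      (∀ h ∈ H1, ∀ u ∈ U, L h u ∈ U) ∧ Module.finrank ℂ U = d :=
    ⟨_, H, le_rfl, hH, W0, le_rfl, hW, hinv, rfl⟩
  obtain ⟨H1, hH1H, hH1, U, hUW, hU, hUinv, hd⟩ := Nat.find_spec hex
  have hUfin : FiniteDimensional ℂ U := Submodule.finiteDimensional_of_le hUW
  have hmin : ∀ K ≤ H, K.FiniteIndex → ∀ U2 ≤ U, U2 ≠ ⊥ → (∀ h ∈ K, ∀ u ∈ U2, L h u ∈ U2) →
      U2 = U := by
    intro K hKH hK U2 hU2 hne hi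
    refine Submodule.eq_of_le_of_finrank_le hU2 ?_
    rw [hd]
    exact Nat.find_min' hex ⟨K, hKH, hK, U2, hU2.trans hUW, hne, hi, rfl⟩
  have Linv : ∀ (h : Γ) (v : V), L h⁻¹ (L h v) = v := by
    intro h v
    rw [← Module.End.mul_apply, ← map_mul]
    simp
  have Linv' : ∀ (h : Γ) (v : V), L h (L h⁻¹ v) = v := by
    intro h v
    rw [← Module.End.mul_apply, ← map_mul]
    simp
  have step : ∀ m : ℕ, (∀ x ∈ H1.lowerCentralSeries (m + 1), ∃ r : ℂ, ∀ u ∈ U, L x u = r • u) →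
      ∀ x ∈ H1.lowerCentralSeries m, ∃ r : ℂ, ∀ u ∈ U, L x u = r • u := by
    intro m hm x hx
    have hxH : x ∈ H1 := H1.lowerCentralSeries_le_self m hx
    let T : Module.End ℂ U := (L x).restrict (hUinv x hxH)
    have : Nontrivial U := Submodule.nontrivial_iff_ne_bot.2 hU
    obtain ⟨μ, hμ⟩ := Module.End.exists_eigenvalue T
    obtain ⟨u, hu⟩ := hμ.exists_hasEigenvector
    have hu1 : L x u = μ • (u : V) := congrArg Subtype.val hu.apply_eq_smul
    have hu0 : (u : V) ≠ 0 := fun h => hu.2 (Subtype.ext h)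
    have hL0 : ∀ (h : Γ) (v : V), v ≠ 0 → L h v ≠ 0 := by
      intro h v hv h0
      apply hv
      rw [← Linv h v, h0, map_zero]
    have hμ0 : μ ≠ 0 := by
      rintro rfl
      apply hL0 x u hu0
      rw [hu1, zero_smul]
    have hs : ∀ h ∈ H1, ∃ s : ℂ, s ≠ 0 ∧ ∀ v ∈ U, L h (L x v) = s • L x (L h v) := by
      intro h hh
      have hmem : ⁅h, x⁆ ∈ H1.lowerCentralSeries (m + 1) := by
        rw [← commutatorElement_inv]
        exact Subgroup.inv_mem _ (Subgroup.commutator_mem_commutator hx hh)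
      obtain ⟨r, hr⟩ := hm _ hmem
      have key : ∀ v ∈ U, L h (L x v) = r • L x (L h v) := by
        intro v hv
        rw [← hr _ (hUinv x hxH _ (hUinv h hh _ hv))]
        simp only [← Module.End.mul_apply, ← map_mul]
        congr 2
        simp [commutatorElement_def, mul_assoc]
      refine ⟨r, ?_, key⟩
      rintro rfl
      apply hL0 h _ (hL0 x u hu0)
      rw [key u u.2, zero_smul]
    choose! s hs0 hs1 using hs
    let K : Subgroup Γ :=
      { carrier := {h | h ∈ H1 ∧ ∀ v ∈ U, L h (L x v) = L x (L h v)}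
        one_mem' := ⟨H1.one_mem, by simp⟩
        mul_mem' := by
          rintro a b ⟨ha, ha'⟩ ⟨hb, hb'⟩
          refine ⟨H1.mul_mem ha hb, fun v hv => ?_⟩
          rw [map_mul, Module.End.mul_apply, Module.End.mul_apply, hb' v hv,
            ha' _ (hUinv b hb v hv)]
        inv_mem' := by
          rintro a ⟨ha, ha'⟩
          refine ⟨H1.inv_mem ha, fun v hv => ?_⟩
          have := ha' (L a⁻¹ v) (hUinv _ (H1.inv_mem ha) v hv)
          rw [Linv'] at this
          rw [← this, Linv] }
    have hK : K.FiniteIndex := by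
      refine finiteIndex_of_map hH1 {z | T.HasEigenvalue z} (Module.End.finite_hasEigenvalue T)
        (fun h => (s h)⁻¹ * μ) ?_ ?_
      · intro h hh
        refine Module.End.hasEigenvalue_of_hasEigenvector
          (x := ⟨L h u, hUinv h hh u u.2⟩) ⟨?_, ?_⟩
        · rw [Module.End.mem_eigenspace_iff]
          apply Subtype.ext
          change L x (L h u) = ((s h)⁻¹ * μ) • L h u
          have := hs1 h hh u u.2
          rw [hu1, map_smul] at this
          rw [mul_smul, this, smul_smul, inv_mul_cancel₀ (hs0 h hh), one_smul]
        · intro h0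
          exact hL0 h u hu0 (congrArg Subtype.val h0)
      · intro h hh k hk heq
        have hsk : s h = s k := by
          simpa [hμ0] using heq
        refine ⟨H1.mul_mem (H1.inv_mem hh) hk, fun v hv => ?_⟩
        rw [map_mul, Module.End.mul_apply, Module.End.mul_apply, hs1 k hk v hv]
        have hw := hs1 h hh (L h⁻¹ (L k v)) (hUinv _ (H1.inv_mem hh) _ (hUinv k hk v hv))
        rw [Linv', hsk] at hw
        rw [← hw, Linv]
    have hU2 := hmin K (fun h hh => hH1H hh.1) hK (U ⊓ Module.End.eigenspace (L x) μ) inf_le_left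
      (by
        intro h0
        apply hu0
        rw [← Submodule.mem_bot ℂ, ← h0]
        exact ⟨u.2, Module.End.mem_eigenspace_iff.2 hu1⟩)
      (by
        rintro h ⟨hh, hh'⟩ v ⟨hv, hv'⟩
        refine ⟨hUinv h hh v hv, Module.End.mem_eigenspace_iff.2 ?_⟩
        rw [← hh' v hv, Module.End.mem_eigenspace_iff.1 hv', map_smul])
    refine ⟨μ, fun v hv => ?_⟩
    rw [← hU2] at hv
    exact Module.End.mem_eigenspace_iff.1 hv.2
  have all : ∀ m : ℕ, (∀ x ∈ H1.lowerCentralSeries m, ∃ r : ℂ, ∀ u ∈ U, L x u = r • u) →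
      ∀ x ∈ H1, ∃ r : ℂ, ∀ u ∈ U, L x u = r • u := by
    intro m
    induction m with
    | zero => exact fun h => h
    | succ m ih => exact fun h => ih (step m h)
  have hall := all n (fun x hx => ⟨1, fun u hu => by
    rw [one_smul]
    exact htriv x (Subgroup.lowerCentralSeries_mono n hH1H hx) u (hUW hu)⟩)
  obtain ⟨u, hu, hu0⟩ := Submodule.exists_mem_ne_zero_of_ne_bot hU
  refine ⟨H1, hH1H, hH1, u, hUW hu, hu0, fun h hh => ?_⟩
  obtain ⟨r, hr⟩ := hall h hh
  exact ⟨r, hr u hu⟩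

lemma nil_cob {G : Type*} [Group G] (ρ : G →* ℂˣ) (u : G → ℂ) (hu : IsCoc ρ u)
    (g₀ : G) (hg₀ : (ρ g₀ : ℂ) ≠ 1) (n : ℕ)
    (hn : ∀ x ∈ (⊤ : Subgroup G).lowerCentralSeries n, u x = 0) : IsCob ρ u := by
  by_contra hnc
  have key : ∀ m, (∀ x ∈ (⊤ : Subgroup G).lowerCentralSeries m, u x = 0) → False := by
    intro m
    induction m with
    | zero =>
      intro h
      exact hnc ⟨0, fun x => by simp [h x trivial]⟩
    | succ m ih =>
      intro h
      apply ih
      have hne : ∃ g, u g ≠ 0 := by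
        by_contra! h0
        exact hnc ⟨0, fun x => by simp [h0 x]⟩
      obtain ⟨g₁, hg₁⟩ := hne
      have hρ1 : ∀ l ∈ (⊤ : Subgroup G).lowerCentralSeries (m + 1), (ρ l : ℂ) = 1 := by
        intro l hl
        have h1 := hu l g₁
        have hl' : g₁⁻¹ * l * g₁ ∈ (⊤ : Subgroup G).lowerCentralSeries (m + 1) := by
          have := (inferInstance :
            ((⊤ : Subgroup G).lowerCentralSeries (m + 1)).Normal).conj_mem l hl g₁⁻¹
          simpa using this
        have h2 := hu g₁ (g₁⁻¹ * l * g₁)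
        rw [h _ hl', show g₁ * (g₁⁻¹ * l * g₁) = l * g₁ by group, h1, h l hl] at h2
        have h3 : ((ρ l : ℂ) - 1) * u g₁ = 0 := by linear_combination h2
        rcases mul_eq_zero.1 h3 with h4 | h4
        · exact sub_eq_zero.1 h4
        · exact absurd h4 hg₁
      intro z hz
      have hcomm : ∀ g, (1 - (ρ g : ℂ)) * u z = (1 - ρ z) * u g := by
        intro g
        have hm : ⁅z, g⁆ ∈ (⊤ : Subgroup G).lowerCentralSeries (m + 1) :=
          Subgroup.commutator_mem_commutator hz trivial
        have h1 : z * g = ⁅z, g⁆ * (g * z) := by simp [commutatorElement_def, mul_assoc]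
        have h2 := hu z g
        rw [h1, hu, h _ hm, hρ1 _ hm, hu] at h2
        linear_combination -h2
      by_cases hρz : (ρ z : ℂ) = 1
      · have h1 := hcomm g₀
        rw [hρz, sub_self, zero_mul] at h1
        rcases mul_eq_zero.1 h1 with h2 | h2
        · exact absurd (sub_eq_zero.1 h2).symm hg₀
        · exact h2
      · exfalso
        apply hnc
        refine ⟨u z / (ρ z - 1), fun x => ?_⟩
        have h1 : (ρ z : ℂ) - 1 ≠ 0 := sub_ne_zero.2 hρz
        field_simp
        linear_combination hcomm x
  exact key n hn

lemma extend_coc {G : Type*} [Group G] (ρ : G →* ℂˣ) (g₀ : G) (hg₀ : (ρ g₀ : ℂ) ≠ 1) (n : ℕ) :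
    ∀ (B : Subgroup G) (_ : B.Normal) (ψ : G → ℂ), (⊤ : Subgroup G).lowerCentralSeries n ≤ B →
      (∀ x ∈ B, ∀ y ∈ B, ψ (x * y) = ψ x + ψ y) →
      (∀ g, ∀ b ∈ B, ψ (g * b * g⁻¹) = ρ g * ψ b) → (∃ b ∈ B, ψ b ≠ 0) →
      ∃ c : G → ℂ, IsCoc ρ c ∧ ∀ b ∈ B, c b = ψ b := by
  induction n with
  | zero =>
    intro B hB ψ hn hadd heq hne
    exfalso
    obtain ⟨b, hb, hb0⟩ := hne
    have h1 := heq g₀ b hb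
    have hg : g₀ ∈ B := hn trivial
    rw [hadd _ (B.mul_mem hg hb) _ (B.inv_mem hg), hadd _ hg _ hb] at h1
    have h2 := hadd _ hg _ (B.inv_mem hg)
    have h3 := hadd 1 B.one_mem 1 B.one_mem
    rw [mul_inv_cancel] at h2
    rw [mul_one] at h3
    have h4 : ((ρ g₀ : ℂ) - 1) * ψ b = 0 := by linear_combination -h1 - h2 - h3
    rcases mul_eq_zero.1 h4 with h | h
    · exact hg₀ (sub_eq_zero.1 h)
    · exact hb0 h
  | succ n ih =>
    intro B hB ψ hn hadd heq hne
    have hψ1 : ψ 1 = 0 := by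
      have h3 := hadd 1 B.one_mem 1 B.one_mem
      rw [mul_one] at h3
      linear_combination -h3
    have hψinv : ∀ b ∈ B, ψ b⁻¹ = - ψ b := by
      intro b hb
      have h2 := hadd _ hb _ (B.inv_mem hb)
      rw [mul_inv_cancel, hψ1] at h2
      linear_combination -h2
    have hZ : ∀ z : G, z ∈ Subgroup.upperCentralSeriesStep B ↔ ∀ g : G, ⁅g, z⁆ ∈ B := by
      intro z
      rw [Subgroup.mem_upperCentralSeriesStep]
      refine forall_congr' fun g => ?_
      rw [← commutatorElement_inv, Subgroup.inv_mem_iff]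
    set Z := Subgroup.upperCentralSeriesStep B with hZdef
    have hcoc : ∀ z ∈ Z, IsCoc ρ (fun g => ψ ⁅g, z⁆) := by
      intro z hz g h
      have e : ⁅g * h, z⁆ = g * ⁅h, z⁆ * g⁻¹ * ⁅g, z⁆ := by
        simp only [commutatorElement_def]; group
      change ψ ⁅g * h, z⁆ = _
      rw [e, hadd _ (hB.conj_mem _ ((hZ z).1 hz h) g) _ ((hZ z).1 hz g),
        heq g _ ((hZ z).1 hz h)]
      ring
    have hBz : ∀ z : G, ∀ b ∈ B, ψ ⁅b, z⁆ = (1 - ρ z) * ψ b := by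
      intro z b hb
      have e : ⁅b, z⁆ = b * (z * b⁻¹ * z⁻¹) := by
        simp only [commutatorElement_def]; group
      rw [e, hadd _ hb _ (hB.conj_mem _ (B.inv_mem hb) z), heq _ _ (B.inv_mem hb), hψinv b hb]
      ring
    by_cases hcase : ∃ z ∈ Z, (ρ z : ℂ) ≠ 1
    · obtain ⟨z, hz, hρz⟩ := hcase
      have h1 : 1 - (ρ z : ℂ) ≠ 0 := sub_ne_zero.2 (Ne.symm hρz)
      refine ⟨fun g => ψ ⁅g, z⁆ / (1 - ρ z), fun x y => ?_, fun b hb => ?_⟩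
      · have := hcoc z hz x y
        simp only at this ⊢
        rw [this]
        ring
      · simp only [hBz z b hb]
        field_simp
    · push Not at hcase
      have hg1 : (ρ g₀ : ℂ) - 1 ≠ 0 := sub_ne_zero.2 hg₀
      have hv : ∀ z ∈ Z, ∀ g : G, ψ ⁅g, z⁆ = (ρ g - 1) * (ψ ⁅g₀, z⁆ / (ρ g₀ - 1)) := by
        intro z hz g
        obtain ⟨v, hv⟩ := nil_cob ρ _ (hcoc z hz) g₀ hg₀ (n + 1) (by
          intro x hx
          rw [hBz z x (hn hx), hcase z hz]
          simp)
        simp only at hv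
        rw [hv g, hv g₀]
        field_simp
      have hBZ : B ≤ Z := by
        intro b hb
        rw [hZ]
        intro g
        exact B.mul_mem (hB.conj_mem b hb g) (B.inv_mem hb)
      let ψ' : G → ℂ := fun z => ψ ⁅g₀, z⁆ / (ρ g₀ - 1)
      have hψ'B : ∀ b ∈ B, ψ' b = ψ b := by
        intro b hb
        have : ψ ⁅g₀, b⁆ = (ρ g₀ - 1) * ψ b := by
          rw [commutatorElement_def, hadd _ (hB.conj_mem b hb g₀) _ (B.inv_mem hb), heq _ _ hb,
            hψinv b hb]
          ring
        simp only [ψ', this]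
        field_simp
      have hadd' : ∀ x ∈ Z, ∀ y ∈ Z, ψ' (x * y) = ψ' x + ψ' y := by
        intro x hx y hy
        have e : ⁅g₀, x * y⁆ = ⁅g₀, x⁆ * (x * ⁅g₀, y⁆ * x⁻¹) := by
          simp only [commutatorElement_def]; group
        simp only [ψ']
        rw [e, hadd _ ((hZ x).1 hx g₀) _ (hB.conj_mem _ ((hZ y).1 hy g₀) x),
          heq _ _ ((hZ y).1 hy g₀), hcase x hx]
        ring
      have hZn : Z.Normal := by
        rw [hZdef, Subgroup.upperCentralSeriesStep_eq_comap_center]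
        infer_instance
      obtain ⟨c, hc, hc'⟩ := ih Z hZn ψ'
        (by
          intro z hz
          rw [hZdef, Subgroup.mem_upperCentralSeriesStep]
          intro y
          exact hn (Subgroup.commutator_mem_commutator hz trivial))
        hadd'
        (by
          intro g z hz
          have e : g * z * g⁻¹ = ⁅g, z⁆ * z := by simp [commutatorElement_def]
          have hgz := (hZ z).1 hz g
          rw [e, hadd' _ (hBZ hgz) _ hz, hψ'B _ hgz, hv z hz g]
          change _ * ψ' z + ψ' z = _
          ring)
        (by
          obtain ⟨b, hb, hb0⟩ := hne
          exact ⟨b, hBZ hb, by rw [hψ'B b hb]; exact hb0⟩)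
      exact ⟨c, hc, fun b hb => by rw [hc' b (hBZ hb), hψ'B b hb]⟩

lemma kron {lam : ℂ} (hint : IsIntegral ℤ lam) (hroot : ∀ n : ℕ, 0 < n → lam ^ n ≠ 1) :
    ∃ σ : algebraicClosure ℚ ℂ →+* ℂ, ∀ x : algebraicClosure ℚ ℂ, (x : ℂ) = lam → ‖σ x‖ ≠ 1 := by
  have hintQ : IsIntegral ℚ lam := hint.tower_top
  let K0 := IntermediateField.adjoin ℚ {lam}
  have : FiniteDimensional ℚ K0 := IntermediateField.adjoin.finiteDimensional hintQ
  have : NumberField K0 := { to_charZero := inferInstance, to_finiteDimensional := inferInstance }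
  let x0 : K0 := IntermediateField.AdjoinSimple.gen ℚ lam
  have hx0 : (x0 : ℂ) = lam := rfl
  have hx0i : IsIntegral ℤ x0 := by
    rw [← isIntegral_algebraMap_iff (A := K0) (B := ℂ) (algebraMap K0 ℂ).injective]
    exact hint
  have h1 : ∃ φ : K0 →+* ℂ, ‖φ x0‖ ≠ 1 := by
    by_contra! h
    obtain ⟨n, hn, hn'⟩ := NumberField.Embeddings.pow_eq_one_of_norm_eq_one K0 ℂ hx0i h
    refine hroot n hn ?_
    have := congrArg (fun y : K0 => (y : ℂ)) hn'
    simpa [hx0] using this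
  obtain ⟨φ, hφ⟩ := h1
  have hmem : lam ∈ algebraicClosure ℚ ℂ := mem_algebraicClosure_iff'.2 hintQ
  have halg : @Algebra.IsAlgebraic ℚ (algebraicClosure ℚ ℂ) _ _ DivisionRing.toRatAlgebra := by
    convert algebraicClosure.isAlgebraic ℚ ℂ
    · rfl
    · exact Subsingleton.elim _ _
  let x : algebraicClosure ℚ ℂ := ⟨lam, hmem⟩
  have hmin : minpoly ℚ x0 = minpoly ℚ x := by
    rw [← minpoly.algebraMap_eq (B := K0) (B' := ℂ) (algebraMap K0 ℂ).injective,
      ← minpoly.algebraMap_eq (B := algebraicClosure ℚ ℂ) (B' := ℂ)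
        (algebraMap (algebraicClosure ℚ ℂ) ℂ).injective]
    rfl
  have hroot2 : φ x0 ∈ (minpoly ℚ x).rootSet ℂ := by
    rw [← hmin, ← NumberField.Embeddings.range_eval_eq_rootSet_minpoly]
    exact ⟨φ, rfl⟩
  rw [← Algebra.IsAlgebraic.range_eval_eq_rootSet_minpoly] at hroot2
  obtain ⟨σ, hσ⟩ := hroot2
  refine ⟨σ, fun y hy => ?_⟩
  have : y = x := Subtype.ext hy
  rw [this]
  change ‖σ x‖ ≠ 1
  simp only at hσ
  rw [hσ]
  exact hφ

end PVN

namespace PVN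

open groupCohomology commutatorElement

lemma le_norm {Γ : Type*} [Group Γ] {H A : Subgroup Γ}
    (h : ∀ g ∈ H, ∀ a ∈ A, g * a * g⁻¹ ∈ A) : H ≤ Subgroup.normalizer (A : Set Γ) := by
  intro g hg
  rw [Subgroup.mem_normalizer_iff]
  intro a
  refine ⟨h g hg a, fun ha => ?_⟩
  have := h g⁻¹ (H.inv_mem hg) _ ha
  simpa [mul_assoc] using this

lemma exists_A0 {Γ : Type*} [Group Γ] (hsol : Group.IsSolvable Γ) {M : Subgroup Γ}
    (hM : (Subgroup.normalizer (M : Set Γ)).FiniteIndex) (hv : ¬ VN M) :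
    ∃ A : Subgroup Γ, M < A ∧ ⁅A, A⁆ ≤ M ∧ (Subgroup.normalizer (A : Set Γ)).FiniteIndex := by
  classical
  let Λ := Subgroup.normalizer (M : Set Γ)
  have hMΛ : M ≤ Λ := Subgroup.le_normalizer
  let N := M.subgroupOf Λ
  have hN : N.Normal := Subgroup.normal_in_normalizer
  have hex : ∃ n, derivedSeries (Λ ⧸ N) n = ⊥ := Group.IsSolvable.solvable
  obtain ⟨j, hj, hjm⟩ : ∃ j, derivedSeries (Λ ⧸ N) (j + 1) = ⊥ ∧ derivedSeries (Λ ⧸ N) j ≠ ⊥ := by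
    have h0 : derivedSeries (Λ ⧸ N) 0 ≠ ⊥ := by
      intro h
      apply hv
      refine ⟨Λ, hM, 0, fun x hx => ?_⟩
      have h1 : QuotientGroup.mk' N ⟨x, hx⟩ ∈ derivedSeries (Λ ⧸ N) 0 := trivial
      rw [h, Subgroup.mem_bot] at h1
      exact (QuotientGroup.eq_one_iff (N := N) ⟨x, hx⟩).1 h1
    obtain ⟨k, hk⟩ := hex
    induction k with
    | zero => exact absurd hk h0
    | succ k ih =>
      by_cases h : derivedSeries (Λ ⧸ N) k = ⊥
      · exact ih h
      · exact ⟨k, hk, h⟩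
  let E := (derivedSeries (Λ ⧸ N) j).comap (QuotientGroup.mk' N)
  have hE : E.Normal := (derivedSeries_normal _ j).comap _
  refine ⟨E.map Λ.subtype, ?_, ?_, ?_⟩
  · refine lt_of_le_of_ne ?_ ?_
    · intro x hx
      refine ⟨⟨x, hMΛ hx⟩, ?_, rfl⟩
      have : QuotientGroup.mk' N ⟨x, hMΛ hx⟩ = 1 := (QuotientGroup.eq_one_iff _).2 hx
      change QuotientGroup.mk' N ⟨x, hMΛ hx⟩ ∈ derivedSeries (Λ ⧸ N) j
      rw [this]
      exact Subgroup.one_mem _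
    · intro h
      apply hjm
      rw [eq_bot_iff]
      intro q hq
      obtain ⟨x, rfl⟩ := QuotientGroup.mk'_surjective N q
      have : (x : Γ) ∈ E.map Λ.subtype := ⟨x, hq, rfl⟩
      rw [← h] at this
      exact (QuotientGroup.eq_one_iff _).2 this
  · rw [Subgroup.commutator_le]
    rintro _ ⟨x, hx, rfl⟩ _ ⟨y, hy, rfl⟩
    have h1 : ⁅QuotientGroup.mk' N x, QuotientGroup.mk' N y⁆ ∈ derivedSeries (Λ ⧸ N) (j + 1) :=
      Subgroup.commutator_mem_commutator hx hy
    rw [hj, Subgroup.mem_bot, ← map_commutatorElement] at h1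
    have h2 := (QuotientGroup.eq_one_iff _).1 h1
    rw [← map_commutatorElement]
    exact h2
  · have := hM
    refine Subgroup.finiteIndex_of_le (H := Λ) (le_norm ?_)
    rintro g hg _ ⟨x, hx, rfl⟩
    exact ⟨⟨g, hg⟩ * x * ⟨g, hg⟩⁻¹, hE.conj_mem x hx _, rfl⟩

lemma integral_char {Γ : Type*} [Group Γ] {A : Subgroup Γ} (hA : A.FG) {φ : Γ → ℂ}
    (hadd : ∀ x ∈ A, ∀ y ∈ A, φ (x * y) = φ x + φ y) {a0 : Γ} (ha0 : a0 ∈ A) (h0 : φ a0 ≠ 0)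
    {h : Γ} (hn : ∀ a ∈ A, h * a * h⁻¹ ∈ A) {r : ℂ} (hr : ∀ a ∈ A, φ (h * a * h⁻¹) = r * φ a) :
    IsIntegral ℤ r := by
  classical
  have h1 : φ 1 = 0 := by
    have h3 := hadd 1 A.one_mem 1 A.one_mem
    rw [mul_one] at h3
    linear_combination -h3
  obtain ⟨S, hS⟩ := hA
  have hSA : ∀ s ∈ S, s ∈ A := fun s hs => by
    rw [← hS]; exact Subgroup.subset_closure hs
  let N : Submodule ℤ ℂ := Submodule.span ℤ (φ '' (S : Set Γ))
  have hmem : ∀ a ∈ A, φ a ∈ N := by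
    intro a ha
    rw [← hS] at ha
    induction ha using Subgroup.closure_induction with
    | mem x hx => exact Submodule.subset_span ⟨x, hx, rfl⟩
    | one => rw [h1]; exact N.zero_mem
    | mul x y hx hy ihx ihy =>
      rw [hS] at hx hy
      rw [hadd x hx y hy]
      exact N.add_mem ihx ihy
    | inv x hx ih =>
      rw [hS] at hx
      have := hadd x hx x⁻¹ (A.inv_mem hx)
      rw [mul_inv_cancel, h1] at this
      rw [show φ x⁻¹ = - φ x by linear_combination -this]
      exact N.neg_mem ih
  refine isIntegral_of_smul_mem_submodule (M := ℂ) N ?_ ?_ r ?_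
  · intro hb
    have := hmem a0 ha0
    rw [hb, Submodule.mem_bot] at this
    exact h0 this
  · exact Submodule.fg_span (S.finite_toSet.image _)
  · intro x hx
    induction hx using Submodule.span_induction with
    | mem x hx =>
      obtain ⟨s, hs, rfl⟩ := hx
      rw [smul_eq_mul, ← hr s (hSA s hs)]
      exact hmem _ (hn s (hSA s hs))
    | zero => simp
    | add x y _ _ ihx ihy => rw [smul_add]; exact N.add_mem ihx ihy
    | smul z x _ ih => rw [smul_comm]; exact N.smul_mem z ih

lemma char_case {Γ : Type} [Group Γ] (hfg : ∀ K : Subgroup Γ, K.FG)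
    (hsym : ∀ Λ : Subgroup Γ, Λ.FiniteIndex →
      ∀ (f₁ f₂ : Λ →* Multiplicative ℝ) (t : ℝ), t ≠ 0 →
        dimH1 (expChar (smulAddChar t f₁) f₂) = dimH1 (expChar f₁ f₂))
    {H A : Subgroup Γ} (hH : H.FiniteIndex) (n : ℕ) (hn : H.lowerCentralSeries n ≤ A)
    (hHA : ∀ h ∈ H, ∀ a ∈ A, h * a * h⁻¹ ∈ A) {φ : Γ → ℂ}
    (hadd : ∀ x ∈ A, ∀ y ∈ A, φ (x * y) = φ x + φ y) {a0 : Γ} (ha0 : a0 ∈ A) (h0 : φ a0 ≠ 0)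
    (ρ : H →* ℂˣ) (hρ : ∀ h : H, ∀ a ∈ A, φ (h * a * (h : Γ)⁻¹) = ρ h * φ a) (g : H) :
    ∃ m : ℕ, 0 < m ∧ (ρ g : ℂ) ^ m = 1 := by
  by_contra! hg
  have hint : ∀ h : H, IsIntegral ℤ (ρ h : ℂ) := fun h =>
    integral_char (hfg A) hadd ha0 h0 (hHA h h.2) (hρ h)
  obtain ⟨σ, hσ⟩ := kron (hint g) hg
  have hK : ∀ h : H, (ρ h : ℂ) ∈ algebraicClosure ℚ ℂ := fun h =>
    mem_algebraicClosure_iff'.2 (hint h).tower_top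
  let ρ' : H →* ℂˣ := MonoidHom.toHomUnits
    { toFun := fun h => σ ⟨ρ h, hK h⟩
      map_one' := by
        rw [← map_one σ]
        congr 1
        ext
        simp
      map_mul' := fun x y => by
        rw [← map_mul σ]
        congr 1
        ext
        simp }
  have hρ' : ∀ h : H, (ρ' h : ℂ) = σ ⟨ρ h, hK h⟩ := fun h => rfl
  obtain ⟨l, hl⟩ : ∃ l : Module.Dual (algebraicClosure ℚ ℂ) ℂ, l (φ a0) ≠ 0 := by
    by_contra! h
    exact h0 ((Module.forall_dual_apply_eq_zero_iff (algebraicClosure ℚ ℂ) _).1 h)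
  let ψ : Γ → ℂ := fun x => σ (l (φ x))
  have hψadd : ∀ x ∈ A, ∀ y ∈ A, ψ (x * y) = ψ x + ψ y := by
    intro x hx y hy
    simp only [ψ, hadd x hx y hy, map_add]
  have hψeq : ∀ h : H, ∀ a ∈ A, ψ (h * a * (h : Γ)⁻¹) = ρ' h * ψ a := by
    intro h a ha
    simp only [ψ, hρ h a ha, hρ']
    rw [← map_mul]
    congr 1
    have : (ρ h : ℂ) * φ a = (⟨ρ h, hK h⟩ : algebraicClosure ℚ ℂ) • φ a := rfl
    rw [this, map_smul, smul_eq_mul]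
  have hψ0 : ψ a0 ≠ 0 := by
    simp only [ψ]
    exact (map_ne_zero σ).2 hl
  have hgn : ‖(ρ' g : ℂ)‖ ≠ 1 := hσ _ rfl
  have hg1 : (ρ' g : ℂ) ≠ 1 := by
    intro h
    apply hgn
    rw [h, norm_one]
  obtain ⟨k, hk, -, hkH⟩ := Subgroup.exists_pow_mem_of_index_ne_zero hH.index_ne_zero a0
  have hψ1 : ψ 1 = 0 := by
    have h3 := hψadd 1 A.one_mem 1 A.one_mem
    rw [mul_one] at h3
    linear_combination -h3
  have hpow : ∀ m : ℕ, ψ (a0 ^ m) = m * ψ a0 := by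
    intro m
    induction m with
    | zero => simp [hψ1]
    | succ m ih =>
      rw [pow_succ, hψadd _ (A.pow_mem ha0 m) _ ha0, ih]
      push_cast
      ring
  let b : H := ⟨a0 ^ k, hkH⟩
  have hbA : (b : Γ) ∈ A := A.pow_mem ha0 k
  have hb0 : ψ b ≠ 0 := by
    change ψ (a0 ^ k) ≠ 0
    rw [hpow]
    exact mul_ne_zero (Nat.cast_ne_zero.2 hk.ne') hψ0
  have hbρ : ρ' b = 1 := by
    have h1 := hψeq b a0 ha0
    have h2 : (b : Γ) * a0 * (b : Γ)⁻¹ = a0 := by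
      change a0 ^ k * a0 * (a0 ^ k)⁻¹ = a0
      rw [← pow_succ, pow_succ', mul_inv_cancel_right]
    rw [h2] at h1
    have h3 : ((ρ' b : ℂ) - 1) * ψ a0 = 0 := by linear_combination -h1
    rcases mul_eq_zero.1 h3 with h | h
    · ext
      simpa using sub_eq_zero.1 h
    · exact absurd h hψ0
  obtain ⟨c, hc, hcB⟩ := extend_coc ρ' g hg1 n (A.subgroupOf H)
    ⟨fun a ha h => hHA h h.2 a ha⟩ (fun x => ψ x)
    (by
      intro x hx
      apply hn
      rw [← Subgroup.top_subtype_lowerCentralSeries]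
      exact ⟨x, hx, rfl⟩)
    (fun x hx y hy => hψadd x hx y hy) (fun h a ha => hψeq h a ha) ⟨b, hbA, hb0⟩
  refine hgn (noBad hfg hsym H hH ρ' c hc b hbρ ?_ g)
  rw [hcB b hbA]
  exact hb0

lemma minimal_step {Γ : Type} [Group Γ] (hfg : ∀ K : Subgroup Γ, K.FG)
    (hsym : ∀ Λ : Subgroup Γ, Λ.FiniteIndex →
      ∀ (f₁ f₂ : Λ →* Multiplicative ℝ) (t : ℝ), t ≠ 0 →
        dimH1 (expChar (smulAddChar t f₁) f₂) = dimH1 (expChar f₁ f₂))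
    {M A : Subgroup Γ} (hnM : (Subgroup.normalizer (M : Set Γ)).FiniteIndex)
    (hnA : (Subgroup.normalizer (A : Set Γ)).FiniteIndex) (hMA : M ≤ A) (hc : ⁅A, A⁆ ≤ M)
    (hW : W M A ≠ ⊥) (hA : VN A) :
    ∃ D : Subgroup Γ, M ≤ D ∧ D ≤ A ∧ (Subgroup.normalizer (D : Set Γ)).FiniteIndex ∧ VN D ∧
      Module.finrank ℂ (W M D) < Module.finrank ℂ (W M A) := by
  classical
  obtain ⟨H0, hH0, n, hn⟩ := hA
  have hfin := W_finite M A (hfg A)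
  let H := H0 ⊓ (Subgroup.normalizer (M : Set Γ) ⊓ Subgroup.normalizer (A : Set Γ))
  have hH : H.FiniteIndex := inferInstance
  have htriv : ∀ h ∈ H.lowerCentralSeries n, ∀ w ∈ W M A, L Γ h w = w := by
    intro h hh w hw
    have hhA : h ∈ A := hn (Subgroup.lowerCentralSeries_mono n inf_le_left hh)
    obtain ⟨w1, w2, w3⟩ := hw
    funext a
    rw [L_apply]
    by_cases ha : a ∈ A
    · have e : h⁻¹ * a * h = ⁅h⁻¹, a⁆ * a := by simp [commutatorElement_def]
      have hm : ⁅h⁻¹, a⁆ ∈ M := hc (Subgroup.commutator_mem_commutator (A.inv_mem hhA) ha)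
      rw [e, w2 _ (hMA hm) _ ha, w3 _ hm, zero_add]
    · rw [w1 a ha, w1]
      intro h'
      apply ha
      have := A.mul_mem (A.mul_mem hhA h') (A.inv_mem hhA)
      simpa [mul_assoc] using this
  obtain ⟨H1, hH1H, hH1, φ, hφ, hφ0, hr⟩ := eigen (L Γ) (W M A) hW H hH
    (fun h hh w hw => L_mem_W hh.2.1 hh.2.2 hw) n htriv
  have hr' : ∀ h ∈ H1, ∃ r : ℂ, ∀ a, φ (h * a * h⁻¹) = r * φ a := by
    intro h hh
    obtain ⟨r, hr⟩ := hr h⁻¹ (H1.inv_mem hh)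
    refine ⟨r, fun a => ?_⟩
    have := congrFun hr a
    rw [L_apply, inv_inv] at this
    simpa using this
  choose! r hr using hr'
  obtain ⟨w1, w2, w3⟩ := id hφ
  obtain ⟨a0, h0⟩ : ∃ a0, φ a0 ≠ 0 := by
    by_contra! h
    exact hφ0 (funext h)
  have ha0 : a0 ∈ A := by
    by_contra h
    exact h0 (w1 a0 h)
  have hHA : ∀ h ∈ H1, ∀ a ∈ A, h * a * h⁻¹ ∈ A := fun h hh a ha =>
    (Subgroup.mem_normalizer_iff.1 (hH1H hh).2.2 a).1 ha
  have r1 : r 1 = 1 := by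
    have := hr 1 H1.one_mem a0
    rw [one_mul, inv_one, mul_one] at this
    have h2 : (r 1 - 1) * φ a0 = 0 := by linear_combination -this
    rcases mul_eq_zero.1 h2 with h | h
    · exact sub_eq_zero.1 h
    · exact absurd h h0
  have rmul : ∀ x ∈ H1, ∀ y ∈ H1, r (x * y) = r x * r y := by
    intro x hx y hy
    have h1 := hr _ (H1.mul_mem hx hy) a0
    rw [show x * y * a0 * (x * y)⁻¹ = x * (y * a0 * y⁻¹) * x⁻¹ by group, hr x hx, hr y hy] at h1
    have h2 : (r (x * y) - r x * r y) * φ a0 = 0 := by linear_combination -h1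
    rcases mul_eq_zero.1 h2 with h | h
    · exact sub_eq_zero.1 h
    · exact absurd h h0
  let ρ : H1 →* ℂˣ := MonoidHom.toHomUnits
    { toFun := fun h => r h
      map_one' := r1
      map_mul' := fun x y => rmul x x.2 y y.2 }
  have hρr : ∀ h : H1, (ρ h : ℂ) = r h := fun h => rfl
  have hn1 : H1.lowerCentralSeries n ≤ A :=
    (Subgroup.lowerCentralSeries_mono n (hH1H.trans inf_le_left)).trans hn
  have htors : ∀ g : H1, ∃ m : ℕ, 0 < m ∧ (ρ g : ℂ) ^ m = 1 :=
    char_case hfg hsym hH1 n hn1 hHA w2 ha0 h0 ρ (fun h a _ => hr h h.2 a)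
  have hG : Group.FG H1 := (Group.fg_iff_subgroup_fg _).2 (hfg H1)
  have hrange : Finite ρ.range := by
    refine CommGroup.finite_of_fg_isMulTorsion _ ?_
    rintro ⟨_, g, rfl⟩
    obtain ⟨m, hm, hm'⟩ := htors g
    rw [isOfFinOrder_iff_pow_eq_one]
    refine ⟨m, hm, ?_⟩
    ext
    simpa using hm'
  have hsfin : (Set.range (fun h : H1 => r h)).Finite := by
    have h1 : (Set.range ρ).Finite := hrange
    refine (h1.image (fun u : ℂˣ => (u : ℂ))).subset ?_
    rintro _ ⟨h, rfl⟩
    exact ⟨ρ h, ⟨h, rfl⟩, rfl⟩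
  let H2 : Subgroup Γ := ρ.ker.map H1.subtype
  have hH21 : H2 ≤ H1 := by
    rintro _ ⟨x, -, rfl⟩
    exact x.2
  have hH2r : ∀ x ∈ H2, r x = 1 := by
    rintro _ ⟨x, hx, rfl⟩
    have : ρ x = 1 := hx
    rw [← Units.val_inj, hρr] at this
    simpa using this
  have hH2 : H2.FiniteIndex := by
    refine finiteIndex_of_map hH1 _ hsfin r (fun h hh => ⟨⟨h, hh⟩, rfl⟩) ?_
    intro h hh k hk heq
    refine ⟨⟨h, hh⟩⁻¹ * ⟨k, hk⟩, ?_, rfl⟩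
    have : ρ ⟨h, hh⟩ = ρ ⟨k, hk⟩ := Units.ext heq
    change ρ _ = 1
    rw [map_mul, map_inv, this, inv_mul_cancel]
  have φ1 : φ 1 = 0 := w3 1 M.one_mem
  have φinv : ∀ x ∈ A, φ x⁻¹ = - φ x := by
    intro x hx
    have := w2 x hx x⁻¹ (A.inv_mem hx)
    rw [mul_inv_cancel, φ1] at this
    linear_combination -this
  let D : Subgroup Γ :=
    { carrier := {a | a ∈ A ∧ φ a = 0}
      one_mem' := ⟨A.one_mem, φ1⟩
      mul_mem' := by
        rintro a b ⟨ha, ha'⟩ ⟨hb, hb'⟩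
        exact ⟨A.mul_mem ha hb, by rw [w2 a ha b hb, ha', hb', add_zero]⟩
      inv_mem' := by
        rintro a ⟨ha, ha'⟩
        exact ⟨A.inv_mem ha, by rw [φinv a ha, ha', neg_zero]⟩ }
  have hMD : M ≤ D := fun x hx => ⟨hMA hx, w3 x hx⟩
  have hDA : D ≤ A := fun x hx => hx.1
  refine ⟨D, hMD, hDA, ?_, ?_, W_lt (hfg A) hMD hDA hc hφ hφ0 (fun x hx => hx.2)⟩
  · refine Subgroup.finiteIndex_of_le (H := H1) (le_norm ?_)
    rintro g hg a ⟨ha, ha'⟩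
    exact ⟨hHA g hg a ha, by rw [hr g hg, ha', mul_zero]⟩
  · refine ⟨H2, hH2, n + 1, ?_⟩
    rw [Subgroup.lowerCentralSeries_succ, Subgroup.commutator_le]
    intro x hx y hy
    have hxA : x ∈ A := hn1 (Subgroup.lowerCentralSeries_mono n hH21 hx)
    have e : ⁅x, y⁆ = x * (y * x⁻¹ * y⁻¹) := by
      simp only [commutatorElement_def]; group
    have hyA := hHA y (hH21 hy) _ (A.inv_mem hxA)
    rw [e]
    refine ⟨A.mul_mem hxA hyA, ?_⟩
    rw [w2 _ hxA _ hyA, hr y (hH21 hy), hH2r y hy, φinv x hxA]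
    ring

lemma not_not_VN {Γ : Type} [Group Γ] (hpoly : IsPolycyclic Γ)
    (hsym : ∀ Λ : Subgroup Γ, Λ.FiniteIndex →
      ∀ (f₁ f₂ : Λ →* Multiplicative ℝ) (t : ℝ), t ≠ 0 →
        dimH1 (expChar (smulAddChar t f₁) f₂) = dimH1 (expChar f₁ f₂)) :
    VN (⊥ : Subgroup Γ) := by
  classical
  have hfg := poly_fg hpoly
  have := acc_of_fg hfg
  by_contra hbot
  obtain ⟨M, ⟨hnM, hvM⟩, hmax⟩ := exists_maximal_of_wellFoundedGT
    (fun M : Subgroup Γ => (Subgroup.normalizer (M : Set Γ)).FiniteIndex ∧ ¬ VN M)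
    ⟨⊥, Subgroup.finiteIndex_of_le (H := ⊤) (le_norm (by
      intro g _ a ha
      rw [Subgroup.mem_bot] at ha ⊢
      simp [ha])), hbot⟩
  have hVN : ∀ B : Subgroup Γ, M < B → (Subgroup.normalizer (B : Set Γ)).FiniteIndex → VN B := by
    intro B hB hnB
    by_contra h
    exact absurd (hmax ⟨hnB, h⟩ hB.le) (not_le_of_gt hB)
  have hWne : ∀ B : Subgroup Γ, M ≤ B → ⁅B, B⁆ ≤ M →
      (Subgroup.normalizer (B : Set Γ)).FiniteIndex → VN B → W M B ≠ ⊥ := by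
    intro B hMB hc hnB hv hW
    exact hvM (VN_of_finite hnM hnB hMB hc (finite_quot (hfg B) hMB hc hW) hv)
  have main : ∀ d : ℕ, ∀ B : Subgroup Γ, M ≤ B → ⁅B, B⁆ ≤ M →
      (Subgroup.normalizer (B : Set Γ)).FiniteIndex → VN B →
      Module.finrank ℂ (W M B) = d → False := by
    intro d
    induction d using Nat.strong_induction_on with
    | _ d ih =>
      intro B hMB hc hnB hv hd
      obtain ⟨D, hMD, hDB, hnD, hvD, hlt⟩ := minimal_step hfg hsym hnM hnB hMB hc
        (hWne B hMB hc hnB hv) hv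
      exact ih _ (hd ▸ hlt) D hMD ((Subgroup.commutator_mono hDB hDB).trans hc) hnD hvD rfl
  obtain ⟨A, hMA, hc, hnA⟩ := exists_A0 (poly_solvable hpoly) hnM hvM
  exact main _ A hMA.le hc hnA (hVN A hMA hnA) rfl

end PVN

/-- A polycyclic group all of whose finite-index subgroups satisfy the
`ℝ*`-symmetry of first cohomology is virtually nilpotent. -/
theorem polycyclic_virtually_nilpotent {Γ : Type} [Group Γ] (hpoly : IsPolycyclic Γ)
    (hsym : ∀ Λ : Subgroup Γ, Λ.FiniteIndex →
      ∀ (f₁ f₂ : Λ →* Multiplicative ℝ) (t : ℝ), t ≠ 0 →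
        dimH1 (expChar (smulAddChar t f₁) f₂) = dimH1 (expChar f₁ f₂)) :
    ∃ H : Subgroup Γ, H.FiniteIndex ∧ Group.IsNilpotent H := by
  obtain ⟨H, hH, n, hn⟩ := PVN.not_not_VN hpoly hsym
  exact ⟨H, hH, Subgroup.isNilpotent_of_lowerCentralSeries_eq_bot (le_bot_iff.1 hn)⟩
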